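/- One has limsup_{μ → 0⁺} m_{1,μ} < 2π·m̂_{1/√(2π)}; in particular there exist μ₀ > 0 and δ > 0 such that m_{1,μ} ≤ 2π·m̂_{1/√(2π)} − δ for all μ ∈ (0, μ₀). -/

import Mathlib

noncomputable section

open MeasureTheory Real Filter

namespace Waveguide

/-- A point of the waveguide `ℝ³ × 𝕋`, modelled as `ℝ³ × ℝ` with functions that are
`2π`-periodic in the second coordinate. -/
abbrev Pt : Type := (Fin 3 → ℝ) × ℝ

/-- The fundamental domain `ℝ³ × (0, 2π]` of the waveguide `ℝ³ × 𝕋`. -/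
def Dom : Set Pt := Set.univ ×ˢ Set.Ioc 0 (2 * π)

/-- `2π`-periodicity in the `y` variable. -/
def PeriodicY (u : Pt → ℝ) : Prop := ∀ x y, u (x, y + 2 * π) = u (x, y)

/-- The `i`-th horizontal coordinate direction. -/
def ex (i : Fin 3) : Pt := (fun j => if j = i then 1 else 0, 0)

/-- The vertical (periodic) direction. -/
def ey : Pt := (0, 1)

/-- `i`-th partial derivative in the `x` variables. -/
def gradx (u : Pt → ℝ) (p : Pt) (i : Fin 3) : ℝ := fderiv ℝ u p (ex i)

/-- Partial derivative in the `y` variable, `u_y`. -/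
def grady (u : Pt → ℝ) (p : Pt) : ℝ := fderiv ℝ u p ey

/-- `|∇_x u|²`. -/
def gradSqX (u : Pt → ℝ) (p : Pt) : ℝ := ∑ i, (gradx u p i) ^ 2

/-- `|∇_{x,y} u|²`. -/
def gradSq (u : Pt → ℝ) (p : Pt) : ℝ := gradSqX u p + (grady u p) ^ 2

/-- Membership in (a regular repesentative of) `H¹(ℝ³ × 𝕋)`, for real valued functions. -/
structure H1 (u : Pt → ℝ) : Prop where
  periodic : PeriodicY u
  diff : Differentiable ℝ u
  memL2 : IntegrableOn (fun p => (u p) ^ 2) Dom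
  memGrad : IntegrableOn (fun p => gradSq u p) Dom
  memL4 : IntegrableOn (fun p => (u p) ^ 4) Dom

/-- The `L²(ℝ³ × 𝕋)` norm. -/
def l2 (u : Pt → ℝ) : ℝ := Real.sqrt (∫ p in Dom, (u p) ^ 2)

/-- `u ∈ S_Θ`. -/
def inS (Θ : ℝ) (u : Pt → ℝ) : Prop := H1 u ∧ l2 u = Θ

/-- The nonlinear density `u⁴ + 2u²v² + v⁴`. -/
def nonlin (u v : Pt → ℝ) (p : Pt) : ℝ :=
  (u p) ^ 4 + 2 * (u p) ^ 2 * (v p) ^ 2 + (v p) ^ 4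

/-- The energy functional `I(u,v)`. -/
def energy (u v : Pt → ℝ) : ℝ :=
  (1 / 2) * (∫ p in Dom, (gradSq u p + gradSq v p))
    - (1 / 4) * ∫ p in Dom, nonlin u v p

/-- The semivirial functional `Q(u,v)`. -/
def svirial (u v : Pt → ℝ) : ℝ :=
  (∫ p in Dom, (gradSqX u p + gradSqX v p))
    - (3 / 4) * ∫ p in Dom, nonlin u v p

/-- The ground-state level `m_Θ`. -/
def mlevel (Θ : ℝ) : ℝ :=
  sInf {c | ∃ u v : Pt → ℝ, inS Θ u ∧ inS Θ v ∧ svirial u v = 0 ∧ energy u v = c}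

/-- `(u,v)` is a minimizer of `m_Θ`: it lies in `V_Θ` and attains the infimum. -/
def isMinimizer (Θ : ℝ) (u v : Pt → ℝ) : Prop :=
  inS Θ u ∧ inS Θ v ∧ svirial u v = 0 ∧ energy u v = mlevel Θ

/-- Smooth, compactly supported (in `x`) test function on the waveguide. -/
def TestFun (φ : Pt → ℝ) : Prop :=
  ContDiff ℝ (⊤ : ℕ∞) φ ∧ PeriodicY φ ∧
    ∃ K : Set (Fin 3 → ℝ), IsCompact K ∧ ∀ p : Pt, p.1 ∉ K → φ p = 0

/-- `u` is a weak solution of `-Δ_{x,y} u + lam u = f` on `ℝ³ × 𝕋`. -/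
def WeakSol (lam : ℝ) (u f : Pt → ℝ) : Prop :=
  ∀ φ : Pt → ℝ, TestFun φ →
    (∫ p in Dom,
        ((∑ i, gradx u p i * gradx φ p i) + grady u p * grady φ p + lam * u p * φ p))
      = ∫ p in Dom, f p * φ p

/-- The mass-preserving rescaling `u^τ(x,y) = τ^{3/2} u(τx, y)`. -/
def scaleX (τ : ℝ) (u : Pt → ℝ) : Pt → ℝ :=
  fun p => τ ^ ((3 : ℝ) / 2) * u (τ • p.1, p.2)

/-- `u` is independent of the `y` variable, i.e. `u_y = 0` (a.e.). -/
def Yindep (u : Pt → ℝ) : Prop := ∀ᵐ p : Pt ∂volume, grady u p = 0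

/-- The functional `J_μ(u,v)`. -/
def Jfun (μ : ℝ) (u v : Pt → ℝ) : ℝ :=
  (1 / 2) * (∫ p in Dom,
      (gradSqX u p + μ * (grady u p) ^ 2 + gradSqX v p + μ * (grady v p) ^ 2))
    - (1 / 4) * ∫ p in Dom, nonlin u v p

/-- The level `m_{1,μ}`. -/
def m1 (μ : ℝ) : ℝ :=
  sInf {c | ∃ u v : Pt → ℝ, inS 1 u ∧ inS 1 v ∧ svirial u v = 0 ∧ Jfun μ u v = c}

/-- `(u,v)` is a minimizer of `m_{1,μ}`. -/
def isMinimizerJ (μ : ℝ) (u v : Pt → ℝ) : Prop :=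
  inS 1 u ∧ inS 1 v ∧ svirial u v = 0 ∧ Jfun μ u v = m1 μ

/-! ### Objects on `ℝ³` -/

abbrev Pt3 : Type := Fin 3 → ℝ

def e3 (i : Fin 3) : Pt3 := fun j => if j = i then 1 else 0

def grad3 (w : Pt3 → ℝ) (x : Pt3) (i : Fin 3) : ℝ := fderiv ℝ w x (e3 i)

def gradSq3 (w : Pt3 → ℝ) (x : Pt3) : ℝ := ∑ i, (grad3 w x i) ^ 2

/-- Membership in (a regular representative of) `H¹(ℝ³)`. -/
structure H1R3 (w : Pt3 → ℝ) : Prop where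
  diff : Differentiable ℝ w
  memL2 : Integrable (fun x => (w x) ^ 2)
  memGrad : Integrable (fun x => gradSq3 w x)
  memL4 : Integrable (fun x => (w x) ^ 4)

/-- The `L²(ℝ³)` norm. -/
def l2R3 (w : Pt3 → ℝ) : ℝ := Real.sqrt (∫ x, (w x) ^ 2)

def nonlin3 (u v : Pt3 → ℝ) (x : Pt3) : ℝ :=
  (u x) ^ 4 + 2 * (u x) ^ 2 * (v x) ^ 2 + (v x) ^ 4

/-- The limit energy `Î(u,v)` on `ℝ³`. -/
def Ihat (u v : Pt3 → ℝ) : ℝ :=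
  (1 / 2) * (∫ x, (gradSq3 u x + gradSq3 v x)) - (1 / 4) * ∫ x, nonlin3 u v x

/-- The virial `Q̂(u,v)` on `ℝ³`. -/
def Qhat (u v : Pt3 → ℝ) : ℝ :=
  (∫ x, (gradSq3 u x + gradSq3 v x)) - (3 / 4) * ∫ x, nonlin3 u v x

/-- The ground-state energy `m̂_ρ` on `ℝ³`. -/
def mhat (ρ : ℝ) : ℝ :=
  sInf {c | ∃ u v : Pt3 → ℝ, H1R3 u ∧ H1R3 v ∧ l2R3 u = ρ ∧ l2R3 v = ρ ∧
    Qhat u v = 0 ∧ Ihat u v = c}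


/-- A differentiable integrable function on the line is bounded by the `L¹` norm of its
derivative. -/
lemma enorm_le_lintegral_enorm_deriv {h : ℝ → ℝ} (hd : Differentiable ℝ h) (hi : Integrable h)
    (t : ℝ) : ‖h t‖ₑ ≤ ∫⁻ s, ‖deriv h s‖ₑ := by
  by_cases hfin : (∫⁻ s, ‖deriv h s‖ₑ) = ⊤
  · rw [hfin]; exact le_top
  have hi' : Integrable (deriv h) :=
    ⟨(measurable_deriv h).aestronglyMeasurable, lt_top_iff_ne_top.2 hfin⟩
  have h0 : Tendsto h atBot (nhds 0) :=
    tendsto_zero_of_hasDerivAt_of_integrableOn_Iic (a := t)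
      (fun x _ => (hd x).hasDerivAt) hi'.integrableOn hi.integrableOn
  have heq := integral_Iic_of_hasDerivAt_of_tendsto' (a := t)
    (fun x _ => (hd x).hasDerivAt) hi'.integrableOn h0
  rw [sub_zero] at heq
  rw [← heq]
  exact (enorm_integral_le_lintegral_enorm _).trans (setLIntegral_le_lintegral _ _)

/-- An integrable function on `ℝ³` is integrable along almost every line in a given coordinate
direction. -/
lemma ae_integrable_update {g : Pt3 → ℝ} (hg : Integrable g) (i : Fin 3) :
    ∀ᵐ x : Pt3, Integrable (fun t => g (Function.update x i t)) := by
  have he := volume_preserving_piFinSuccAbove (fun _ : Fin 3 => ℝ) i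
  have hg' : Integrable (fun z => g ((MeasurableEquiv.piFinSuccAbove (fun _ => ℝ) i).symm z)) :=
    (he.symm _).integrable_comp_of_integrable hg
  rw [Measure.volume_eq_prod] at hg'
  have h1 := hg'.prod_left_ae
  have h2 := (Measure.quasiMeasurePreserving_snd (μ := (volume : Measure ℝ))
    (ν := (volume : Measure (Fin 2 → ℝ)))).ae h1
  rw [← Measure.volume_eq_prod] at h2
  have h3 := he.quasiMeasurePreserving.ae h2
  filter_upwards [h3] with x hx
  refine hx.congr (Eventually.of_forall fun t => ?_)
  simp [MeasurableEquiv.piFinSuccAbove_symm_apply, Fin.insertNthEquiv,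
    MeasurableEquiv.piFinSuccAbove_apply]

/-- The endpoint Sobolev inequality on `ℝ³`, for differentiable integrable functions whose partial
derivatives are dominated by `G`. -/
lemma lintegral_rpow_le_of_partial_le {g : Pt3 → ℝ} (hd : Differentiable ℝ g) (hi : Integrable g)
    {G : Pt3 → ENNReal} (hG : Measurable G) (hgG : ∀ x i, ‖grad3 g x i‖ₑ ≤ G x) :
    ∫⁻ x, ‖g x‖ₑ ^ ((3 : ℝ) / 2) ≤ (∫⁻ x, G x) ^ ((3 : ℝ) / 2) := by
  have hp : Real.HolderConjugate (Fintype.card (Fin 3) : ℝ) ((3 : ℝ) / 2) := by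
    rw [Real.holderConjugate_iff]; norm_num
  refine le_trans ?_ (lintegral_prod_lintegral_pow_le (fun _ : Fin 3 => (volume : Measure ℝ)) hp hG)
  refine lintegral_mono_ae ?_
  have hall : ∀ᵐ x : Pt3, ∀ i, Integrable (fun t => g (Function.update x i t)) :=
    ae_all_iff.2 fun i => ae_integrable_update hi i
  filter_upwards [hall] with x hx
  have key : ∀ i, ‖g x‖ₑ ≤ ∫⁻ t, G (Function.update x i t) := fun i => by
    have hder : ∀ t, HasDerivAt (fun t => g (Function.update x i t))
        (grad3 g (Function.update x i t) i) t := fun t => by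
      have h := (hd (Function.update x i t)).hasFDerivAt.comp_hasDerivAt t
        (hasDerivAt_update x i t)
      rwa [show (Pi.single i 1 : Pt3) = e3 i from funext fun j => by simp [e3, Pi.single_apply]]
        at h
    have h := enorm_le_lintegral_enorm_deriv (fun t => (hder t).differentiableAt) (hx i) (x i)
    rw [Function.update_eq_self] at h
    refine h.trans (lintegral_mono fun t => ?_)
    rw [(hder t).deriv]
    exact hgG _ _
  calc ‖g x‖ₑ ^ ((3 : ℝ) / 2)
      = ∏ _i : Fin 3, ‖g x‖ₑ ^ ((1 : ℝ) / (Fintype.card (Fin 3) - 1 : ℝ)) := by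
        rw [Finset.prod_const, ← ENNReal.rpow_natCast, ← ENNReal.rpow_mul]
        norm_num
    _ ≤ _ := by
        refine Finset.prod_le_prod' fun i _ => ?_
        exact ENNReal.rpow_le_rpow (key i) (by norm_num)

lemma measurable_gradSq3 (u : Pt3 → ℝ) : Measurable (gradSq3 u) := by
  unfold gradSq3 grad3
  exact Finset.measurable_sum _ fun i _ => (measurable_fderiv_apply_const ℝ u (e3 i)).pow_const 2

lemma gradSq3_nonneg (u : Pt3 → ℝ) (x : Pt3) : 0 ≤ gradSq3 u x :=
  Finset.sum_nonneg fun _ _ => sq_nonneg _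

lemma abs_grad3_le (u : Pt3 → ℝ) (x : Pt3) (i : Fin 3) : |grad3 u x i| ≤ √(gradSq3 u x) := by
  rw [← Real.sqrt_sq_eq_abs]
  exact Real.sqrt_le_sqrt
    (Finset.single_le_sum (f := fun i => grad3 u x i ^ 2) (fun _ _ => sq_nonneg _)
      (Finset.mem_univ i))

/-- The Gagliardo–Nirenberg inequality `‖u‖₄⁴ ≤ 27 ‖u‖₂ ‖∇u‖₂³` on `ℝ³`, squared. -/
theorem gagliardo_nirenberg {u : Pt3 → ℝ} (hu : H1R3 u) :
    (∫ x, u x ^ 4) ^ 2 ≤ 729 * (∫ x, u x ^ 2) * (∫ x, gradSq3 u x) ^ 3 := by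
  have hum : Measurable u := hu.diff.continuous.measurable
  set U : Pt3 → ENNReal := fun x => ‖u x‖ₑ with hU
  set G : Pt3 → ENNReal := fun x => ENNReal.ofReal √(gradSq3 u x) with hG
  have hUm : Measurable U := hum.enorm
  have hGm : Measurable G := (measurable_gradSq3 u).sqrt.ennreal_ofReal
  have hUp : ∀ x (n : ℕ), Even n → U x ^ n = ENNReal.ofReal (u x ^ n) := fun x n hn => by
    rw [hU]; dsimp only
    rw [← ofReal_norm, ← ENNReal.ofReal_pow (norm_nonneg _), Real.norm_eq_abs,
      hn.pow_abs]
  have hA : ∫⁻ x, U x ^ 4 = ENNReal.ofReal (∫ x, u x ^ 4) := by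
    rw [ofReal_integral_eq_lintegral_ofReal hu.memL4 (Eventually.of_forall fun x => by positivity)]
    exact lintegral_congr fun x => hUp x 4 (by decide)
  have hM : ∫⁻ x, U x ^ 2 = ENNReal.ofReal (∫ x, u x ^ 2) := by
    rw [ofReal_integral_eq_lintegral_ofReal hu.memL2 (Eventually.of_forall fun x => by positivity)]
    exact lintegral_congr fun x => hUp x 2 (by decide)
  have hD : ∫⁻ x, G x ^ 2 = ENNReal.ofReal (∫ x, gradSq3 u x) := by
    rw [ofReal_integral_eq_lintegral_ofReal hu.memGrad
      (Eventually.of_forall fun x => gradSq3_nonneg u x)]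
    refine lintegral_congr fun x => ?_
    rw [hG]; dsimp only
    rw [← ENNReal.ofReal_pow (Real.sqrt_nonneg _), Real.sq_sqrt (gradSq3_nonneg u x)]
  have hcube : Integrable (fun x => u x ^ 3) := by
    refine (hu.memL2.add hu.memL4).mono' (hum.pow_const 3).aestronglyMeasurable
      (Eventually.of_forall fun x => ?_)
    simp only [Pi.add_apply, Real.norm_eq_abs]
    rw [abs_le]
    constructor <;> nlinarith [sq_nonneg (u x * (u x - 1)), sq_nonneg (u x * (u x + 1)),
      sq_nonneg (u x), sq_nonneg (u x ^ 2)]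
  have hsob : ∫⁻ x, ‖u x ^ 3‖ₑ ^ ((3 : ℝ) / 2) ≤
      (∫⁻ x, 3 * (U x ^ 2 * G x)) ^ ((3 : ℝ) / 2) := by
    refine lintegral_rpow_le_of_partial_le (g := fun x => u x ^ 3)
      (hu.diff.pow 3) hcube (by fun_prop) fun x i => ?_
    have hgr : grad3 (fun x => u x ^ 3) x i = 3 * (u x ^ 2 * grad3 u x i) := by
      unfold grad3
      have h := ((hu.diff x).hasFDerivAt.pow 3).fderiv
      rw [h]
      simp
      ring
    rw [hgr, enorm_mul, enorm_mul, enorm_pow]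
    have h3 : ‖(3 : ℝ)‖ₑ = 3 := by
      rw [← ofReal_norm]; norm_num
    rw [h3]
    gcongr
    rw [← ofReal_norm]
    exact ENNReal.ofReal_le_ofReal (abs_grad3_le u x i)
  have hcs : ∫⁻ x, U x ^ 2 * G x ≤
      (∫⁻ x, U x ^ 4) ^ ((1 : ℝ) / 2) * (∫⁻ x, G x ^ 2) ^ ((1 : ℝ) / 2) := by
    have h := ENNReal.lintegral_mul_norm_pow_le (μ := (volume : Measure Pt3))
      (hUm.pow_const 4).aemeasurable (hGm.pow_const 2).aemeasurable
      (p := (1 : ℝ) / 2) (q := (1 : ℝ) / 2) (by norm_num) (by norm_num) (by norm_num)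
    refine le_trans (le_of_eq (lintegral_congr fun x => ?_)) h
    rw [← ENNReal.rpow_natCast (U x) 4, ← ENNReal.rpow_natCast (G x) 2, ← ENNReal.rpow_mul,
      ← ENNReal.rpow_mul, ← ENNReal.rpow_natCast (U x) 2]
    norm_num
  have hinterp : ∫⁻ x, U x ^ 4 ≤ (∫⁻ x, U x ^ 2) ^ ((1 : ℝ) / 5) *
      (∫⁻ x, ‖u x ^ 3‖ₑ ^ ((3 : ℝ) / 2)) ^ ((4 : ℝ) / 5) := by
    have h := ENNReal.lintegral_mul_norm_pow_le (μ := (volume : Measure Pt3))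
      (hUm.pow_const 2).aemeasurable
      (((hum.pow_const 3).enorm).pow_const ((3 : ℝ) / 2)).aemeasurable
      (p := (1 : ℝ) / 5) (q := (4 : ℝ) / 5) (by norm_num) (by norm_num) (by norm_num)
    refine le_trans (le_of_eq (lintegral_congr fun x => ?_)) h
    rw [enorm_pow, ← ENNReal.rpow_natCast (U x) 2, ← ENNReal.rpow_natCast _ 3,
      ← ENNReal.rpow_mul, ← ENNReal.rpow_mul, ← ENNReal.rpow_mul,
      ← ENNReal.rpow_add_of_nonneg _ _ (by norm_num) (by norm_num), ← ENNReal.rpow_natCast (U x) 4]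
    norm_num
  rw [lintegral_const_mul _ (by fun_prop)] at hsob
  have hA0 : 0 ≤ ∫ x, u x ^ 4 := integral_nonneg fun x => by positivity
  have hM0 : 0 ≤ ∫ x, u x ^ 2 := integral_nonneg fun x => by positivity
  have hD0 : 0 ≤ ∫ x, gradSq3 u x := integral_nonneg fun x => gradSq3_nonneg u x
  rw [hA, hD] at hcs
  rw [hA, hM] at hinterp
  generalize (∫ x, u x ^ 4) = A at *
  generalize (∫ x, u x ^ 2) = M at *
  generalize (∫ x, gradSq3 u x) = D at *
  generalize (∫⁻ x, ‖u x ^ 3‖ₑ ^ ((3 : ℝ) / 2)) = S at *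
  generalize (∫⁻ x, U x ^ 2 * G x) = B at *
  have h6 : B ^ 6 ≤ ENNReal.ofReal A ^ 3 * ENNReal.ofReal D ^ 3 := by
    calc B ^ 6 ≤ _ := pow_le_pow_left' hcs 6
      _ = _ := by
        rw [mul_pow]
        simp only [← ENNReal.rpow_natCast, ← ENNReal.rpow_mul]
        norm_num
  have hS4 : S ^ 4 ≤ (3 * B) ^ 6 := by
    calc S ^ 4 ≤ _ := pow_le_pow_left' hsob 4
      _ = _ := by
        simp only [← ENNReal.rpow_natCast, ← ENNReal.rpow_mul]
        norm_num
  have h5 : ENNReal.ofReal A ^ 5 ≤ ENNReal.ofReal M * S ^ 4 := by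
    calc ENNReal.ofReal A ^ 5 ≤ _ := pow_le_pow_left' hinterp 5
      _ = _ := by
        rw [mul_pow]
        simp only [← ENNReal.rpow_natCast, ← ENNReal.rpow_mul]
        norm_num
  have hfin : ENNReal.ofReal (A ^ 5) ≤ ENNReal.ofReal (M * (729 * (A ^ 3 * D ^ 3))) := by
    rw [ENNReal.ofReal_pow hA0, ENNReal.ofReal_mul hM0, ENNReal.ofReal_mul (by norm_num),
      ENNReal.ofReal_mul (by positivity), ENNReal.ofReal_pow hA0, ENNReal.ofReal_pow hD0]
    refine h5.trans (mul_le_mul_right (hS4.trans ?_) _)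
    rw [mul_pow]
    refine mul_le_mul' ?_ h6
    norm_num
  have hreal := (ENNReal.ofReal_le_ofReal_iff
    (mul_nonneg hM0 (mul_nonneg (by norm_num) (mul_nonneg (pow_nonneg hA0 3) (pow_nonneg hD0 3))))).1
    hfin
  rcases hA0.eq_or_lt with h | h
  · rw [← h, zero_pow two_ne_zero]; positivity
  · have hA3 : 0 < A ^ 3 := by positivity
    refine le_of_mul_le_mul_left ?_ hA3
    nlinarith [hreal]

lemma gradSq3_const_mul_comp_smul {b : Pt3 → ℝ} (hb : Differentiable ℝ b) (a τ : ℝ) (x : Pt3) :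
    gradSq3 (fun x => a * b (τ • x)) x = a ^ 2 * τ ^ 2 * gradSq3 b (τ • x) := by
  have h : ∀ i, grad3 (fun x => a * b (τ • x)) x i = a * τ * grad3 b (τ • x) i := fun i => by
    unfold grad3
    have hd : DifferentiableAt ℝ (fun x => b (τ • x)) x :=
      (hb (τ • x)).comp x (differentiableAt_id.const_smul τ)
    rw [fderiv_const_mul hd, fderiv_comp_smul]
    simp [mul_assoc]
  unfold gradSq3
  rw [Finset.mul_sum]
  exact Finset.sum_congr rfl fun i _ => by rw [h i]; ring

/-- Profiles on `ℝ³` with prescribed mass and prescribed ratio between the Dirichlet energy and the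
quartic term. -/
lemma exists_profile : ∃ κ : ℝ, 0 < κ ∧ ∀ P l : ℝ, 0 < P → 0 < l → ∃ w : Pt3 → ℝ, H1R3 w ∧
    ∫ x, w x ^ 2 = P ∧ 2 * ∫ x, gradSq3 w x = 3 * l * ∫ x, w x ^ 4 ∧
    ∫ x, gradSq3 w x = κ / (l ^ 2 * P) := by
  let φ : ContDiffBump (0 : Pt3) := ⟨1, 2, one_pos, one_lt_two⟩
  obtain ⟨b, hbφ⟩ : ∃ b : Pt3 → ℝ, b = φ := ⟨_, rfl⟩
  have hbc : ContDiff ℝ 1 b := hbφ ▸ φ.contDiff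
  have hbs : HasCompactSupport b := hbφ ▸ φ.hasCompactSupport
  have hb0 : b 0 ≠ 0 := by rw [hbφ, φ.one_of_mem_closedBall (by simp [φ])]; exact one_ne_zero
  have hbd : Differentiable ℝ b := hbc.differentiable one_ne_zero
  have hpc : ∀ n : ℕ, n ≠ 0 → HasCompactSupport fun x => b x ^ n := fun n hn =>
    hbs.comp_left (g := fun t => t ^ n) (zero_pow hn)
  have hH : H1R3 b := by
    refine ⟨hbd, (hbc.continuous.pow 2).integrable_of_hasCompactSupport (hpc 2 two_ne_zero), ?_,
      (hbc.continuous.pow 4).integrable_of_hasCompactSupport (hpc 4 four_ne_zero)⟩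
    have hcf : Continuous (fderiv ℝ b) := hbc.continuous_fderiv one_ne_zero
    refine Continuous.integrable_of_hasCompactSupport ?_ ?_
    · unfold gradSq3 grad3
      fun_prop
    · exact (hbs.fderiv ℝ).comp_left (g := fun L : Pt3 →L[ℝ] ℝ => ∑ i, (L (e3 i)) ^ 2) (by simp)
  have hpos : ∀ n : ℕ, n ≠ 0 → Even n → 0 < ∫ x, b x ^ n := fun n hn he =>
    (hbc.continuous.pow n).integral_pos_of_hasCompactSupport_nonneg_nonzero (hpc n hn)
      (fun x => he.pow_nonneg _) (x := 0) (pow_ne_zero n hb0)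
  have hM := hpos 2 two_ne_zero (by decide)
  have hA := hpos 4 four_ne_zero (by decide)
  have hgn := gagliardo_nirenberg hH
  have hDnn : 0 ≤ ∫ x, gradSq3 b x := integral_nonneg fun x => gradSq3_nonneg b x
  obtain ⟨M, hMe⟩ : ∃ M, M = ∫ x, b x ^ 2 := ⟨_, rfl⟩
  obtain ⟨A, hAe⟩ : ∃ A, A = ∫ x, b x ^ 4 := ⟨_, rfl⟩
  obtain ⟨D, hDe⟩ : ∃ D, D = ∫ x, gradSq3 b x := ⟨_, rfl⟩
  rw [← hMe] at hM
  rw [← hAe] at hA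
  rw [← hMe, ← hAe, ← hDe] at hgn
  rw [← hDe] at hDnn
  have hD : 0 < D := by
    refine hDnn.lt_of_ne fun h => ?_
    rw [← h] at hgn
    have : 0 < A ^ 2 := by positivity
    norm_num at hgn
    linarith
  refine ⟨4 * D ^ 3 * M / (9 * A ^ 2), by positivity, fun P l hP hl => ?_⟩
  obtain ⟨τ, hτe⟩ : ∃ τ, τ = 2 * D * M / (3 * l * A * P) := ⟨_, rfl⟩
  have hτ : 0 < τ := by rw [hτe]; positivity
  obtain ⟨a, hae⟩ : ∃ a, a = √(P * τ ^ 3 / M) := ⟨_, rfl⟩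
  have ha2 : a ^ 2 = P * τ ^ 3 / M := by rw [hae]; exact Real.sq_sqrt (by positivity)
  have hscale : ∀ f : Pt3 → ℝ, ∫ x, f (τ • x) = (τ ^ 3)⁻¹ * ∫ x, f x := fun f => by
    rw [Measure.integral_comp_smul_of_nonneg volume f τ (hR := hτ.le)]
    simp
  have hp : ∀ (n : ℕ) (x : Pt3), (a * b (τ • x)) ^ n = a ^ n * b (τ • x) ^ n := fun n x =>
    mul_pow _ _ _
  have hg := gradSq3_const_mul_comp_smul hbd a τ
  have hI2 : ∫ x, (a * b (τ • x)) ^ 2 = a ^ 2 * ((τ ^ 3)⁻¹ * M) := by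
    simp_rw [hp]
    rw [integral_const_mul, hscale (fun x => b x ^ 2), hMe]
  have hI4 : ∫ x, (a * b (τ • x)) ^ 4 = a ^ 4 * ((τ ^ 3)⁻¹ * A) := by
    simp_rw [hp]
    rw [integral_const_mul, hscale (fun x => b x ^ 4), hAe]
  have hID : ∫ x, gradSq3 (fun x => a * b (τ • x)) x = a ^ 2 * τ ^ 2 * ((τ ^ 3)⁻¹ * D) := by
    simp_rw [hg]
    rw [integral_const_mul, hscale (gradSq3 b), hDe]
  refine ⟨fun x => a * b (τ • x), ⟨?_, ?_, ?_, ?_⟩, ?_, ?_, ?_⟩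
  · fun_prop
  · simp_rw [hp]
    exact (hH.memL2.comp_smul hτ.ne').const_mul _
  · simp_rw [hg]
    exact (hH.memGrad.comp_smul hτ.ne').const_mul _
  · simp_rw [hp]
    exact (hH.memL4.comp_smul hτ.ne').const_mul _
  · rw [hI2, ha2]; field_simp
  · rw [hID, hI4, show a ^ 4 = (a ^ 2) ^ 2 by ring, ha2, hτe]; field_simp
  · rw [hID, ha2, hτe]; field_simp; ring

lemma integrable_mul_sq {α : Type*} [MeasurableSpace α] {m : Measure α} {u v : α → ℝ}
    (hum : AEStronglyMeasurable u m) (hvm : AEStronglyMeasurable v m)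
    (hu : Integrable (fun x => u x ^ 4) m) (hv : Integrable (fun x => v x ^ 4) m) :
    Integrable (fun x => 2 * u x ^ 2 * v x ^ 2) m := by
  refine (hu.add hv).mono' (((hum.pow 2).const_mul 2).mul (hvm.pow 2))
    (Eventually.of_forall fun x => ?_)
  rw [Real.norm_of_nonneg (by positivity)]
  simp only [Pi.add_apply]
  nlinarith [sq_nonneg (u x ^ 2 - v x ^ 2)]

/-- The ground-state energy on `ℝ³` is strictly positive. -/
lemma mhat_pos {ρ : ℝ} (hρ : 0 < ρ) : 0 < mhat ρ := by
  unfold mhat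
  have hne : {c | ∃ u v : Pt3 → ℝ, H1R3 u ∧ H1R3 v ∧ l2R3 u = ρ ∧ l2R3 v = ρ ∧
      Qhat u v = 0 ∧ Ihat u v = c}.Nonempty := by
    obtain ⟨κ, -, h⟩ := exists_profile
    obtain ⟨w, hw, hw2, hwQ, -⟩ := h (ρ ^ 2) 1 (by positivity) one_pos
    have hl : l2R3 w = ρ := by
      unfold l2R3; rw [hw2]; exact Real.sqrt_sq hρ.le
    refine ⟨_, w, w, hw, hw, hl, hl, ?_, rfl⟩
    unfold Qhat nonlin3
    rw [integral_add hw.memGrad hw.memGrad]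
    have h4 : ∀ x, w x ^ 4 + 2 * w x ^ 2 * w x ^ 2 + w x ^ 4 = 4 * w x ^ 4 := fun x => by ring
    simp_rw [h4]
    rw [integral_const_mul]
    linarith
  have hc : 0 < 1 / (6561 * ρ ^ 2) / 6 := by positivity
  refine lt_of_lt_of_le hc (le_csInf hne ?_)
  rintro c ⟨u, v, hu, hv, hlu, hlv, hQ, rfl⟩
  have hgu := gagliardo_nirenberg hu
  have hgv := gagliardo_nirenberg hv
  have hmass : ∀ w : Pt3 → ℝ, l2R3 w = ρ → ∫ x, w x ^ 2 = ρ ^ 2 := fun w h => by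
    rw [← h]; exact (Real.sq_sqrt (integral_nonneg fun x => by positivity)).symm
  have hKs := integral_add hu.memGrad hv.memGrad
  have hN : ∫ x, nonlin3 u v x ≤ 2 * (∫ x, u x ^ 4) + 2 * ∫ x, v x ^ 4 := by
    rw [← integral_const_mul, ← integral_const_mul,
      ← integral_add (hu.memL4.const_mul 2) (hv.memL4.const_mul 2)]
    refine integral_mono ?_ ((hu.memL4.const_mul 2).add (hv.memL4.const_mul 2)) fun x => ?_
    · exact (hu.memL4.add (integrable_mul_sq hu.diff.continuous.aestronglyMeasurable
        hv.diff.continuous.aestronglyMeasurable hu.memL4 hv.memL4)).add hv.memL4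
    · simp only [nonlin3]
      nlinarith [sq_nonneg (u x ^ 2 - v x ^ 2)]
  have hu0 : (∫ x, u x ^ 4) ≠ 0 := fun h => by
    rw [integral_eq_zero_iff_of_nonneg (fun x => by positivity) hu.memL4] at h
    have h2 : ∫ x, u x ^ 2 = 0 := by
      refine integral_eq_zero_of_ae (h.mono fun x hx => ?_)
      have : u x = 0 := by simpa using hx
      simp [this]
    rw [hmass u hlu] at h2
    exact hρ.ne' (by simpa using h2)
  have hua : 0 ≤ ∫ x, u x ^ 4 := integral_nonneg fun x => by positivity
  have hva : 0 ≤ ∫ x, v x ^ 4 := integral_nonneg fun x => by positivity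
  have hud : 0 ≤ ∫ x, gradSq3 u x := integral_nonneg fun x => gradSq3_nonneg u x
  have hvd : 0 ≤ ∫ x, gradSq3 v x := integral_nonneg fun x => gradSq3_nonneg v x
  rw [hmass u hlu] at hgu
  rw [hmass v hlv] at hgv
  unfold Qhat at hQ
  unfold Ihat
  rw [hKs] at hQ ⊢
  generalize (∫ x, u x ^ 4) = a at *
  generalize (∫ x, v x ^ 4) = b at *
  generalize (∫ x, gradSq3 u x) = d at *
  generalize (∫ x, gradSq3 v x) = e at *
  generalize (∫ x, nonlin3 u v x) = N at *
  have hρ2 : 0 < ρ ^ 2 := by positivity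
  generalize ρ ^ 2 = P at *
  have hKN : d + e ≤ 3 / 2 * (a + b) := by linarith
  have hd3 : d ^ 3 ≤ (d + e) ^ 3 := pow_le_pow_left₀ hud (by linarith) 3
  have he3 : e ^ 3 ≤ (d + e) ^ 3 := pow_le_pow_left₀ hvd (by linarith) 3
  have hK0 : 0 ≤ d + e := by linarith
  have ha : a ^ 2 ≤ 729 * P * (d + e) ^ 3 := hgu.trans (by gcongr)
  have hb : b ^ 2 ≤ 729 * P * (d + e) ^ 3 := hgv.trans (by gcongr)
  have hK2 : (d + e) ^ 2 ≤ 6561 * P * (d + e) ^ 3 := by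
    have h1 : (d + e) ^ 2 ≤ (3 / 2 * (a + b)) ^ 2 := pow_le_pow_left₀ hK0 hKN 2
    nlinarith [sq_nonneg (a - b)]
  have hKpos : 0 < d + e := by
    refine hK0.lt_of_ne fun h => hu0 ?_
    rw [← h] at ha
    norm_num at ha
    nlinarith
  have hK1 : 1 ≤ (d + e) * (6561 * P) := by
    have : 0 < (d + e) ^ 2 := by positivity
    refine le_of_mul_le_mul_left ?_ this
    nlinarith
  have hK : 1 / (6561 * P) ≤ d + e := by
    rw [div_le_iff₀ (by positivity)]; exact hK1
  linarith

lemma integral_sin_pow_succ_period (k : ℕ) :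
    ∫ y in (0 : ℝ)..2 * π, sin y ^ (2 * (k + 1)) =
      (1 - 1 / (2 * k + 2)) * ∫ y in (0 : ℝ)..2 * π, sin y ^ (2 * k) := by
  rw [show 2 * (k + 1) = 2 * k + 2 by ring, integral_sin_pow]
  have : (2 * (k : ℝ) + 2) ≠ 0 := by positivity
  simp only [sin_zero, sin_two_pi, Nat.cast_mul, Nat.cast_ofNat]
  rw [zero_pow (by lia)]
  field_simp
  ring

lemma integral_sin_pow_period_pos (k : ℕ) : 0 < ∫ y in (0 : ℝ)..2 * π, sin y ^ (2 * k) := by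
  induction k with
  | zero => simp [pi_pos]
  | succ k ih =>
    rw [integral_sin_pow_succ_period]
    refine mul_pos ?_ ih
    rw [sub_pos, div_lt_one (by positivity)]
    linarith [(Nat.cast_nonneg k : (0 : ℝ) ≤ k)]

lemma sq_integral_sin_pow_period_le (k : ℕ) :
    (∫ y in (0 : ℝ)..2 * π, sin y ^ (2 * k)) ^ 2 * (2 * k + 1) ≤ 4 * π ^ 2 := by
  induction k with
  | zero => simp; nlinarith
  | succ k ih =>
    rw [integral_sin_pow_succ_period]
    refine le_trans ?_ ih
    have hk : (0 : ℝ) < 2 * k + 2 := by positivity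
    have h : (1 - 1 / (2 * (k : ℝ) + 2)) ^ 2 * (2 * ((k + 1 : ℕ) : ℝ) + 1) ≤ 2 * k + 1 := by
      have h1 : 1 - 1 / (2 * (k : ℝ) + 2) = (2 * k + 1) / (2 * k + 2) := by field_simp; ring
      rw [h1, div_pow, div_mul_eq_mul_div, div_le_iff₀ (by positivity)]
      push_cast
      nlinarith [(Nat.cast_nonneg k : (0 : ℝ) ≤ k)]
    rw [mul_pow]
    nlinarith [mul_le_mul_of_nonneg_left h
      (sq_nonneg (∫ y in (0 : ℝ)..2 * π, sin y ^ (2 * k)))]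

lemma half_integral_sin_pow_period_le (k : ℕ) :
    (∫ y in (0 : ℝ)..2 * π, sin y ^ (2 * k)) / 2 ≤
      ∫ y in (0 : ℝ)..2 * π, sin y ^ (2 * (2 * k)) := by
  have hc0 : (0 : ℝ) ≤ 1 / (2 * k + 2) := by positivity
  have hc1 : 1 / (2 * (k : ℝ) + 2) ≤ 1 := by
    rw [div_le_one (by positivity)]; linarith [(Nat.cast_nonneg k : (0 : ℝ) ≤ k)]
  have h : ∀ j : ℕ, (1 - j * (1 / (2 * (k : ℝ) + 2))) * (∫ y in (0 : ℝ)..2 * π, sin y ^ (2 * k)) ≤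
      ∫ y in (0 : ℝ)..2 * π, sin y ^ (2 * (k + j)) := fun j => by
    induction j with
    | zero => simp
    | succ j ih =>
      rw [← add_assoc, integral_sin_pow_succ_period]
      have hk := integral_sin_pow_period_pos k
      have hkj := integral_sin_pow_period_pos (k + j)
      have hle : 1 / (2 * ((k + j : ℕ) : ℝ) + 2) ≤ 1 / (2 * (k : ℝ) + 2) := by
        push_cast; gcongr; linarith [(Nat.cast_nonneg j : (0 : ℝ) ≤ j)]
      generalize 1 / (2 * ((k + j : ℕ) : ℝ) + 2) = c' at *
      generalize 1 / (2 * (k : ℝ) + 2) = c at *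
      generalize (∫ y in (0 : ℝ)..2 * π, sin y ^ (2 * k)) = I at *
      generalize (∫ y in (0 : ℝ)..2 * π, sin y ^ (2 * (k + j))) = I' at *
      push_cast
      have h1 : (1 - c) * I' ≤ (1 - c') * I' :=
        mul_le_mul_of_nonneg_right (by linarith) hkj.le
      have h2 := mul_le_mul_of_nonneg_left ih (sub_nonneg.2 hc1)
      have h3 : 0 ≤ (j : ℝ) * c * c * I := by positivity
      nlinarith
  have hk := h k
  rw [← two_mul k] at hk
  refine le_trans ?_ hk
  have : (1 : ℝ) / 2 ≤ 1 - k * (1 / (2 * k + 2)) := by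
    have hpos : (0 : ℝ) < 2 * k + 2 := by positivity
    rw [mul_one_div, le_sub_comm, div_le_iff₀ hpos]
    linarith
  nlinarith [integral_sin_pow_period_pos k]

/-- Periodic functions whose quartic integral is arbitrarily large relative to their mass. -/
lemma exists_concentrated {ε : ℝ} (hε : 0 < ε) : ∃ f : ℝ → ℝ, ContDiff ℝ 1 f ∧
    (∀ y, f (y + 2 * π) = f y) ∧ 0 < (∫ y in Set.Ioc 0 (2 * π), f y ^ 2) ∧
    0 < (∫ y in Set.Ioc 0 (2 * π), f y ^ 4) ∧
    (∫ y in Set.Ioc 0 (2 * π), f y ^ 2) ^ 4 ≤ ε * (∫ y in Set.Ioc 0 (2 * π), f y ^ 4) ^ 2 := by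
  obtain ⟨n, hn⟩ := exists_nat_ge (16 * π ^ 2 / ε)
  have h2 : ∫ y in Set.Ioc 0 (2 * π), (sin y ^ n) ^ 2 =
      ∫ y in (0 : ℝ)..2 * π, sin y ^ (2 * n) := by
    rw [intervalIntegral.integral_of_le (by positivity)]
    simp_rw [← pow_mul, mul_comm]
  have h4 : ∫ y in Set.Ioc 0 (2 * π), (sin y ^ n) ^ 4 =
      ∫ y in (0 : ℝ)..2 * π, sin y ^ (2 * (2 * n)) := by
    rw [intervalIntegral.integral_of_le (by positivity)]
    simp_rw [← pow_mul, show n * 4 = 2 * (2 * n) by ring]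
  refine ⟨fun y => sin y ^ n, contDiff_sin.pow n, fun y => by simp, ?_, ?_, ?_⟩
  · rw [h2]; exact integral_sin_pow_period_pos n
  · rw [h4]; exact integral_sin_pow_period_pos (2 * n)
  · rw [h2, h4]
    have hI := integral_sin_pow_period_pos n
    have ha := sq_integral_sin_pow_period_le n
    have hb := half_integral_sin_pow_period_le n
    generalize (∫ y in (0 : ℝ)..2 * π, sin y ^ (2 * n)) = I at *
    generalize (∫ y in (0 : ℝ)..2 * π, sin y ^ (2 * (2 * n))) = I' at *
    rw [div_le_iff₀ hε] at hn
    have hIε : 4 * I ^ 2 ≤ ε := by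
      have h0 : 4 * I ^ 2 * (2 * n + 1) ≤ ε * (2 * n + 1) := by nlinarith
      exact le_of_mul_le_mul_right h0 (by positivity)
    have hb2 : (I / 2) ^ 2 ≤ I' ^ 2 := pow_le_pow_left₀ (by positivity) hb 2
    calc I ^ 4 = 4 * I ^ 2 * (I / 2) ^ 2 := by ring
      _ ≤ ε * I' ^ 2 := by gcongr

lemma measurable_gradSqX (u : Pt → ℝ) : Measurable (gradSqX u) := by
  unfold gradSqX gradx
  exact Finset.measurable_sum _ fun i _ => (measurable_fderiv_apply_const ℝ u (ex i)).pow_const 2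

lemma gradSqX_nonneg (u : Pt → ℝ) (p : Pt) : 0 ≤ gradSqX u p :=
  Finset.sum_nonneg fun _ _ => sq_nonneg _

lemma H1.integrableOn_gradSqX {u : Pt → ℝ} (hu : H1 u) : IntegrableOn (gradSqX u) Dom := by
  refine hu.memGrad.mono' (measurable_gradSqX u).aestronglyMeasurable
    (Eventually.of_forall fun p => ?_)
  rw [Real.norm_of_nonneg (gradSqX_nonneg u p)]
  exact le_add_of_nonneg_right (sq_nonneg _)

lemma H1.integrableOn_grady_sq {u : Pt → ℝ} (hu : H1 u) :
    IntegrableOn (fun p => grady u p ^ 2) Dom := by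
  refine hu.memGrad.mono'
    ((measurable_fderiv_apply_const ℝ u ey).pow_const 2).aestronglyMeasurable
    (Eventually.of_forall fun p => ?_)
  rw [Real.norm_of_nonneg (sq_nonneg _)]
  exact le_add_of_nonneg_left (gradSqX_nonneg u p)

lemma Jfun_nonneg {μ : ℝ} (hμ : 0 < μ) {u v : Pt → ℝ} (hu : H1 u) (hv : H1 v)
    (hQ : svirial u v = 0) : 0 ≤ Jfun μ u v := by
  have hle : ∫ p in Dom, (gradSqX u p + gradSqX v p) ≤ ∫ p in Dom,
      (gradSqX u p + μ * (grady u p) ^ 2 + gradSqX v p + μ * (grady v p) ^ 2) := by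
    refine integral_mono (hu.integrableOn_gradSqX.add hv.integrableOn_gradSqX)
      (((hu.integrableOn_gradSqX.add (hu.integrableOn_grady_sq.const_mul μ)).add
        hv.integrableOn_gradSqX).add (hv.integrableOn_grady_sq.const_mul μ)) fun p => ?_
    have h1 := mul_nonneg hμ.le (sq_nonneg (grady u p))
    have h2 := mul_nonneg hμ.le (sq_nonneg (grady v p))
    simp only
    linarith
  have h0 : 0 ≤ ∫ p in Dom, (gradSqX u p + gradSqX v p) :=
    integral_nonneg fun p => add_nonneg (gradSqX_nonneg u p) (gradSqX_nonneg v p)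
  unfold svirial at hQ
  unfold Jfun
  linarith

lemma m1_nonneg {μ : ℝ} (hμ : 0 < μ) : 0 ≤ m1 μ := by
  refine Real.sInf_nonneg ?_
  rintro c ⟨u, v, hu, hv, hQ, rfl⟩
  exact Jfun_nonneg hμ hu.1 hv.1 hQ

lemma m1_le {μ : ℝ} (hμ : 0 < μ) {u v : Pt → ℝ} (hu : inS 1 u) (hv : inS 1 v)
    (hQ : svirial u v = 0) : m1 μ ≤ Jfun μ u v := by
  refine csInf_le ⟨0, ?_⟩ ⟨u, v, hu, hv, hQ, rfl⟩
  rintro c ⟨u, v, hu, hv, hQ, rfl⟩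
  exact Jfun_nonneg hμ hu.1 hv.1 hQ

lemma integral_Dom_mul (g : Pt3 → ℝ) (h : ℝ → ℝ) :
    ∫ p in Dom, g p.1 * h p.2 = (∫ x, g x) * ∫ y in Set.Ioc 0 (2 * π), h y := by
  rw [Dom, Measure.volume_eq_prod, setIntegral_prod_mul, setIntegral_univ]

lemma integrableOn_Dom_mul {g : Pt3 → ℝ} {h : ℝ → ℝ} (hg : Integrable g) (hh : Continuous h) :
    IntegrableOn (fun p : Pt => g p.1 * h p.2) Dom := by
  have hh' : IntegrableOn h (Set.Ioc 0 (2 * π)) :=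
    (hh.integrableOn_Icc (a := 0) (b := 2 * π)).mono_set Set.Ioc_subset_Icc_self
  rw [IntegrableOn, Dom, Measure.volume_eq_prod, ← Measure.prod_restrict, Measure.restrict_univ]
  exact hg.mul_prod hh'

lemma hasFDerivAt_mul_prod {w : Pt3 → ℝ} {f : ℝ → ℝ} (hw : Differentiable ℝ w)
    (hf : Differentiable ℝ f) (p : Pt) :
    HasFDerivAt (fun p : Pt => w p.1 * f p.2)
      (w p.1 • (deriv f p.2 • ContinuousLinearMap.snd ℝ Pt3 ℝ) +
        f p.2 • (fderiv ℝ w p.1).comp (ContinuousLinearMap.fst ℝ Pt3 ℝ)) p := by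
  have h1 : HasFDerivAt (fun p : Pt => w p.1)
      ((fderiv ℝ w p.1).comp (ContinuousLinearMap.fst ℝ Pt3 ℝ)) p :=
    (hw p.1).hasFDerivAt.comp p hasFDerivAt_fst
  have h2 : HasFDerivAt (fun p : Pt => f p.2) (deriv f p.2 • ContinuousLinearMap.snd ℝ Pt3 ℝ) p :=
    (hf p.2).hasDerivAt.comp_hasFDerivAt p hasFDerivAt_snd
  exact h1.mul h2

lemma gradSqX_mul_prod {w : Pt3 → ℝ} {f : ℝ → ℝ} (hw : Differentiable ℝ w)
    (hf : Differentiable ℝ f) (p : Pt) :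
    gradSqX (fun p : Pt => w p.1 * f p.2) p = gradSq3 w p.1 * f p.2 ^ 2 := by
  unfold gradSqX gradSq3
  rw [Finset.sum_mul]
  refine Finset.sum_congr rfl fun i _ => ?_
  unfold gradx grad3
  rw [(hasFDerivAt_mul_prod hw hf p).fderiv]
  rw [show ex i = (e3 i, 0) from rfl]
  simp
  ring

lemma grady_mul_prod {w : Pt3 → ℝ} {f : ℝ → ℝ} (hw : Differentiable ℝ w)
    (hf : Differentiable ℝ f) (p : Pt) :
    grady (fun p : Pt => w p.1 * f p.2) p = w p.1 * deriv f p.2 := by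
  unfold grady
  rw [(hasFDerivAt_mul_prod hw hf p).fderiv]
  simp [ey]

/-- As `μ → 0`, the levels `m_{1,μ}` become arbitrarily small. -/
lemma exists_m1_le {ε : ℝ} (hε : 0 < ε) :
    ∃ C : ℝ, 0 ≤ C ∧ ∀ μ : ℝ, 0 < μ → m1 μ ≤ ε + C * μ := by
  obtain ⟨κ, hκ, hprof⟩ := exists_profile
  obtain ⟨f, hfc, hfp, hF2, hF4, hF⟩ := exists_concentrated (show 0 < 3 * ε / κ by positivity)
  obtain ⟨F2, hF2e⟩ : ∃ F2, F2 = ∫ y in Set.Ioc 0 (2 * π), f y ^ 2 := ⟨_, rfl⟩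
  obtain ⟨F4, hF4e⟩ : ∃ F4, F4 = ∫ y in Set.Ioc 0 (2 * π), f y ^ 4 := ⟨_, rfl⟩
  obtain ⟨E, hEe⟩ : ∃ E, E = ∫ y in Set.Ioc 0 (2 * π), deriv f y ^ 2 := ⟨_, rfl⟩
  rw [← hF2e, ← hF4e] at hF
  rw [← hF2e] at hF2
  rw [← hF4e] at hF4
  have hE : 0 ≤ E := hEe ▸ integral_nonneg fun y => sq_nonneg _
  obtain ⟨w, hw, hw2, hwQ, hwD⟩ := hprof (1 / F2) (F4 / F2) (by positivity) (by positivity)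
  have hfd : Differentiable ℝ f := hfc.differentiable one_ne_zero
  have hf' : Continuous (deriv f) := hfc.continuous_deriv_one
  obtain ⟨u, hu⟩ : ∃ u : Pt → ℝ, u = fun p => w p.1 * f p.2 := ⟨_, rfl⟩
  have hpow : ∀ (n : ℕ) p, u p ^ n = w p.1 ^ n * f p.2 ^ n := fun n p => by rw [hu, mul_pow]
  have hgx : ∀ p, gradSqX u p = gradSq3 w p.1 * f p.2 ^ 2 := fun p => by
    rw [hu]; exact gradSqX_mul_prod hw.diff hfd p
  have hgy : ∀ p, grady u p ^ 2 = w p.1 ^ 2 * deriv f p.2 ^ 2 := fun p => by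
    rw [hu, grady_mul_prod hw.diff hfd p, mul_pow]
  have hix : IntegrableOn (fun p : Pt => gradSq3 w p.1 * f p.2 ^ 2) Dom :=
    integrableOn_Dom_mul (h := fun y => f y ^ 2) hw.memGrad (hfc.continuous.pow 2)
  have hiy : IntegrableOn (fun p : Pt => w p.1 ^ 2 * deriv f p.2 ^ 2) Dom :=
    integrableOn_Dom_mul (g := fun x => w x ^ 2) (h := fun y => deriv f y ^ 2) hw.memL2 (hf'.pow 2)
  have hH : H1 u := by
    refine ⟨fun x y => by simp only [hu, hfp], ?_, ?_, ?_, ?_⟩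
    · rw [hu]; exact fun p => (hasFDerivAt_mul_prod hw.diff hfd p).differentiableAt
    · simp_rw [hpow]
      exact integrableOn_Dom_mul (g := fun x => w x ^ 2) (h := fun y => f y ^ 2) hw.memL2
        (hfc.continuous.pow 2)
    · unfold gradSq
      simp_rw [hgx, hgy]
      exact hix.add hiy
    · simp_rw [hpow]
      exact integrableOn_Dom_mul (g := fun x => w x ^ 4) (h := fun y => f y ^ 4) hw.memL4
        (hfc.continuous.pow 4)
  have hS : inS 1 u := by
    refine ⟨hH, ?_⟩
    unfold l2
    simp_rw [hpow]
    rw [integral_Dom_mul (fun x => w x ^ 2) (fun y => f y ^ 2), hw2, ← hF2e,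
      one_div_mul_cancel hF2.ne', Real.sqrt_one]
  have hIx : ∫ p in Dom, gradSqX u p = (∫ x, gradSq3 w x) * F2 := by
    simp_rw [hgx]
    rw [integral_Dom_mul (gradSq3 w) (fun y => f y ^ 2), ← hF2e]
  have hIy : ∫ p in Dom, grady u p ^ 2 = 1 / F2 * E := by
    simp_rw [hgy]
    rw [integral_Dom_mul (fun x => w x ^ 2) (fun y => deriv f y ^ 2), hw2, ← hEe]
  have hIN : ∫ p in Dom, nonlin u u p = 4 * ((∫ x, w x ^ 4) * F4) := by
    have h : ∀ p, nonlin u u p = 4 * (w p.1 ^ 4 * f p.2 ^ 4) := fun p => by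
      rw [← hpow]; unfold nonlin; ring
    simp_rw [h]
    rw [integral_const_mul, integral_Dom_mul (fun x => w x ^ 4) (fun y => f y ^ 4), ← hF4e]
  have hbal : 2 * ((∫ x, gradSq3 w x) * F2) = 3 * ((∫ x, w x ^ 4) * F4) := by
    have : 2 * ((∫ x, gradSq3 w x) * F2) = (2 * ∫ x, gradSq3 w x) * F2 := by ring
    rw [this, hwQ]
    field_simp
  have hQ : svirial u u = 0 := by
    unfold svirial
    rw [integral_add hH.integrableOn_gradSqX hH.integrableOn_gradSqX, hIx, hIN]
    linarith
  have hsmall : (∫ x, gradSq3 w x) * F2 ≤ 3 * ε := by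
    rw [hwD, div_mul_eq_mul_div, div_le_iff₀ (by positivity)]
    rw [div_mul_eq_mul_div, le_div_iff₀ hκ] at hF
    field_simp
    linarith
  refine ⟨1 / F2 * E, by positivity, fun μ hμ => (m1_le hμ hS hS hQ).trans ?_⟩
  have hJ : ∫ p in Dom, (gradSqX u p + μ * (grady u p) ^ 2 + gradSqX u p + μ * (grady u p) ^ 2) =
      2 * ((∫ x, gradSq3 w x) * F2) + 2 * (μ * (1 / F2 * E)) := by
    have h : ∀ p, gradSqX u p + μ * (grady u p) ^ 2 + gradSqX u p + μ * (grady u p) ^ 2 =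
        2 * gradSqX u p + 2 * μ * grady u p ^ 2 := fun p => by ring
    simp_rw [h]
    rw [integral_add (hH.integrableOn_gradSqX.const_mul 2)
      (hH.integrableOn_grady_sq.const_mul (2 * μ)), integral_const_mul, integral_const_mul, hIx,
      hIy]
    ring
  unfold Jfun
  rw [hJ, hIN]
  linarith

/-- `limsup_{μ → 0⁺} m_{1,μ} < 2π m̂_{1/√(2π)}`; in particular `m_{1,μ}` is
bounded away from `2π m̂_{1/√(2π)}` near `μ = 0`. -/
theorem m1_limsup_lt_at_zero :
    Filter.limsup m1 (nhdsWithin 0 (Set.Ioi 0)) < 2 * π * mhat (1 / Real.sqrt (2 * π)) ∧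
    ∃ μ₀ δ : ℝ, 0 < μ₀ ∧ 0 < δ ∧
      ∀ μ : ℝ, 0 < μ → μ < μ₀ → m1 μ ≤ 2 * π * mhat (1 / Real.sqrt (2 * π)) - δ := by
  have hpos : 0 < 2 * π * mhat (1 / Real.sqrt (2 * π)) :=
    mul_pos two_pi_pos (mhat_pos (by positivity))
  generalize 2 * π * mhat (1 / Real.sqrt (2 * π)) = L at *
  obtain ⟨C, hC, hm⟩ := exists_m1_le (show 0 < L / 4 by positivity)
  have hμ₀ : 0 < L / (4 * (C + 1)) := by positivity
  have hbound : ∀ μ : ℝ, 0 < μ → μ < L / (4 * (C + 1)) → m1 μ ≤ L - L / 2 := fun μ h0 h1 => by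
    have h := hm μ h0
    rw [lt_div_iff₀ (by positivity)] at h1
    nlinarith
  refine ⟨?_, L / (4 * (C + 1)), L / 2, hμ₀, by positivity, hbound⟩
  have hlim : Filter.limsup m1 (nhdsWithin 0 (Set.Ioi 0)) ≤ L - L / 2 := by
    refine Filter.limsup_le_of_le ?_ ?_
    · refine Filter.isCoboundedUnder_le_of_eventually_le _ (x := 0) ?_
      filter_upwards [self_mem_nhdsWithin] with μ hμ
      exact m1_nonneg hμ
    · filter_upwards [Ioo_mem_nhdsGT hμ₀] with μ hμ
      exact hbound μ hμ.1 hμ.2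
  linarith

end Waveguide
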